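/- If the pair (U,V) of bounded linear operators on H satisfies the symplectic relations and Z is a transposition-symmetric bounded operator with ‖Z‖ < 1, then the operator ζ(U,V; Z) is again transposition-symmetric: ζ(U,V; Z) = (ζ(U,V; Z))ᵀ. -/

import Mathlib

open ContinuousLinearMap
open scoped InnerProductSpace

variable {H : Type*} [NormedAddCommGroup H] [InnerProductSpace ℂ H] [CompleteSpace H]

/-- The complex conjugate `Ā := J ∘ A ∘ J` of a bounded operator with respect to the
conjugation `J`. -/
noncomputable def conjOp (J : H →L⋆[ℂ] H) (A : H →L[ℂ] H) : H →L[ℂ] H :=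
  (J.comp A).comp J

/-- The transpose `Aᵀ := J ∘ A* ∘ J` of a bounded operator with respect to the
conjugation `J`. -/
noncomputable def transp (J : H →L⋆[ℂ] H) (A : H →L[ℂ] H) : H →L[ℂ] H :=
  conjOp J (adjoint A)

/-- The pair `(U, V)` satisfies the symplectic relations:
`U U* − V V* = 1`, `U Vᵀ = V Uᵀ`, `U* U − Vᵀ V̄ = 1`, `Uᵀ V̄ = V* U`. -/
def SymplecticPair (J : H →L⋆[ℂ] H) (U V : H →L[ℂ] H) : Prop :=
  U ∘L adjoint U - V ∘L adjoint V = 1 ∧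
  U ∘L transp J V = V ∘L transp J U ∧
  adjoint U ∘L U - transp J V ∘L conjOp J V = 1 ∧
  transp J U ∘L conjOp J V = adjoint V ∘L U

/-- The Siegel-disc action `ζ(U,V; Z) := (U* + Z V*)⁻¹ (Vᵀ + Z Uᵀ)`. -/
noncomputable def zeta (J : H →L⋆[ℂ] H) (U V Z : H →L[ℂ] H) : H →L[ℂ] H :=
  Ring.inverse (adjoint U + Z ∘L adjoint V) ∘L (transp J V + Z ∘L transp J U)

/-- A conjugate-linear isometry reverses inner products. -/
lemma inner_conjugation (J : H →L⋆[ℂ] H) (hJnorm : ∀ x, ‖J x‖ = ‖x‖) (x y : H) :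
    ⟪J x, J y⟫_ℂ = ⟪y, x⟫_ℂ := by
  have hadd : ‖J x + J y‖ = ‖x + y‖ := by rw [← map_add, hJnorm]
  have hsub : ‖J x - J y‖ = ‖x - y‖ := by rw [← map_sub, hJnorm]
  have hsubI : ‖J x - Complex.I • J y‖ = ‖x + Complex.I • y‖ := by
    rw [← hJnorm (x + Complex.I • y), map_add, map_smulₛₗ]
    simp [sub_eq_add_neg]
  have haddI : ‖J x + Complex.I • J y‖ = ‖x - Complex.I • y‖ := by
    rw [← hJnorm (x - Complex.I • y), map_sub, map_smulₛₗ]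
    simp [sub_eq_add_neg]
  rw [← inner_conj_symm y x, inner_eq_sum_norm_sq_div_four x y,
    inner_eq_sum_norm_sq_div_four (J x) (J y)]
  simp only [RCLike.I_to_complex, hadd, hsub, hsubI, haddI]
  have hfour : (starRingEnd ℂ) 4 = 4 := map_ofNat _ 4
  simp [hfour]
  ring

lemma conjOp_conjOp (J : H →L⋆[ℂ] H) (hJinv : ∀ x, J (J x) = x) (A : H →L[ℂ] H) :
    conjOp J (conjOp J A) = A := by
  ext x; simp [conjOp, hJinv]

lemma conjOp_one (J : H →L⋆[ℂ] H) (hJinv : ∀ x, J (J x) = x) :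
    conjOp J (1 : H →L[ℂ] H) = 1 := by
  ext x; simp [conjOp, hJinv]

lemma conjOp_mul (J : H →L⋆[ℂ] H) (hJinv : ∀ x, J (J x) = x) (A B : H →L[ℂ] H) :
    conjOp J (A * B) = conjOp J A * conjOp J B := by
  ext x; simp [conjOp, hJinv]

lemma conjOp_add (J : H →L⋆[ℂ] H) (A B : H →L[ℂ] H) :
    conjOp J (A + B) = conjOp J A + conjOp J B := by
  ext x; simp [conjOp]

lemma conjOp_sub (J : H →L⋆[ℂ] H) (A B : H →L[ℂ] H) :
    conjOp J (A - B) = conjOp J A - conjOp J B := by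
  ext x; simp [conjOp]

lemma adjoint_conjOp (J : H →L⋆[ℂ] H) (hJinv : ∀ x, J (J x) = x) (hJnorm : ∀ x, ‖J x‖ = ‖x‖)
    (A : H →L[ℂ] H) : adjoint (conjOp J A) = conjOp J (adjoint A) := by
  symm
  rw [eq_adjoint_iff]
  intro x y
  change ⟪J (adjoint A (J x)), y⟫_ℂ = ⟪x, J (A (J y))⟫_ℂ
  rw [← hJinv y, inner_conjugation J hJnorm, hJinv, adjoint_inner_right,
    ← inner_conjugation J hJnorm, hJinv]

lemma transp_add (J : H →L⋆[ℂ] H) (A B : H →L[ℂ] H) :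
    transp J (A + B) = transp J A + transp J B := by
  simp only [transp, map_add, conjOp_add]

lemma transp_mul (J : H →L⋆[ℂ] H) (hJinv : ∀ x, J (J x) = x) (A B : H →L[ℂ] H) :
    transp J (A * B) = transp J B * transp J A := by
  rw [transp, mul_def, adjoint_comp, ← mul_def, conjOp_mul J hJinv]; rfl

lemma transp_one (J : H →L⋆[ℂ] H) (hJinv : ∀ x, J (J x) = x) :
    transp J (1 : H →L[ℂ] H) = 1 := by
  rw [transp, ← star_eq_adjoint, star_one, conjOp_one J hJinv]

lemma transp_zero (J : H →L⋆[ℂ] H) : transp J (0 : H →L[ℂ] H) = 0 := by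
  ext x; simp [transp, conjOp]

lemma transp_transp (J : H →L⋆[ℂ] H) (hJinv : ∀ x, J (J x) = x) (hJnorm : ∀ x, ‖J x‖ = ‖x‖)
    (A : H →L[ℂ] H) : transp J (transp J A) = A := by
  rw [transp, transp, adjoint_conjOp J hJinv hJnorm, adjoint_adjoint, conjOp_conjOp J hJinv]

lemma transp_adjoint (J : H →L⋆[ℂ] H) (A : H →L[ℂ] H) :
    transp J (adjoint A) = conjOp J A := by
  rw [transp, adjoint_adjoint]

/-- The numerator and denominator of the Siegel-disc action satisfy `Q Pᵀ = P Qᵀ`. -/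
lemma SymplecticPair.numerator_mul_transp_denominator {J : H →L⋆[ℂ] H}
    (hJinv : ∀ x, J (J x) = x) (hJnorm : ∀ x, ‖J x‖ = ‖x‖) {U V : H →L[ℂ] H}
    (h : SymplecticPair J U V) {Z : H →L[ℂ] H} (hZsym : Z = transp J Z) :
    (transp J V + Z * transp J U) * transp J (adjoint U + Z * adjoint V) =
      (adjoint U + Z * adjoint V) * transp J (transp J V + Z * transp J U) := by
  obtain ⟨-, -, hUU, hUV⟩ := h
  simp only [← mul_def] at hUU hUV
  have hVU : transp J V * conjOp J U = adjoint U * V := by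
    have := congrArg adjoint hUV
    simpa only [transp, mul_def, adjoint_comp, adjoint_conjOp J hJinv hJnorm,
      adjoint_adjoint] using this
  have hUU_conj : transp J U * conjOp J U - adjoint V * V = 1 := by
    have := congrArg (conjOp J) hUU
    simpa only [transp, conjOp_sub, conjOp_mul J hJinv, conjOp_conjOp J hJinv,
      conjOp_one J hJinv] using this
  simp only [transp_add, transp_mul J hJinv, transp_adjoint, transp_transp J hJinv hJnorm,
    ← hZsym]
  calc (transp J V + Z * transp J U) * (conjOp J U + conjOp J V * Z)
      = transp J V * conjOp J U + (transp J V * conjOp J V) * Z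
          + Z * (transp J U * conjOp J U) + Z * (transp J U * conjOp J V) * Z := by noncomm_ring
    _ = adjoint U * V + (adjoint U * U - 1) * Z + Z * (1 + adjoint V * V)
          + Z * (adjoint V * U) * Z := by
        rw [hVU, hUV, ← sub_eq_iff_eq_add.mp hUU_conj, ← hUU, sub_sub_cancel]
    _ = (adjoint U + Z * adjoint V) * (V + U * Z) := by noncomm_ring

/-- The operator `ζ(U,V; Z)` is again transposition-symmetric. -/
theorem statement11 (J : H →L⋆[ℂ] H) (hJinv : ∀ x, J (J x) = x) (hJnorm : ∀ x, ‖J x‖ = ‖x‖)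
    (U V : H →L[ℂ] H) (h : SymplecticPair J U V)
    (Z : H →L[ℂ] H) (hZsym : Z = transp J Z) (hZ : ‖Z‖ < 1) :
    zeta J U V Z = transp J (zeta J U V Z) := by
  by_cases hP : IsUnit (adjoint U + Z * adjoint V)
  · have hQP := h.numerator_mul_transp_denominator hJinv hJnorm hZsym
    simp only [zeta, ← mul_def]
    set P := adjoint U + Z * adjoint V
    set Q := transp J V + Z * transp J U
    have hinv : transp J P * transp J (Ring.inverse P) = 1 := by
      rw [← transp_mul J hJinv, Ring.inverse_mul_cancel P hP, transp_one J hJinv]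
    calc Ring.inverse P * Q
        = Ring.inverse P * (Q * transp J P) * transp J (Ring.inverse P) := by
          rw [mul_assoc, mul_assoc, hinv, mul_one]
      _ = transp J (Ring.inverse P * Q) := by
          rw [hQP, ← mul_assoc, Ring.inverse_mul_cancel P hP, one_mul, transp_mul J hJinv]
  · have hzero : zeta J U V Z = 0 := by
      rw [zeta, ← mul_def Z (adjoint V), Ring.inverse_non_unit _ hP, zero_comp]
    rw [hzero, transp_zero]
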